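/- Full-line Gaussian–erf integral. For all real a and b, ∫_{−∞}^{∞} e^{−x²}·erf(ax+b) dx = √π·erf(b/√(1+a²)). -/

import Mathlib

open MeasureTheory

/-- The error function `erf x = (2/√π) ∫₀ˣ e^{−s²} ds`. -/
noncomputable def erf (x : ℝ) : ℝ :=
  (2 / Real.sqrt Real.pi) * ∫ s in (0 : ℝ)..x, Real.exp (-s ^ 2)

theorem integrable_exp_neg_sq : Integrable fun x : ℝ => Real.exp (-x ^ 2) := by
  simpa using integrable_exp_neg_mul_sq one_pos

theorem hasDerivAt_erf (x : ℝ) :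
    HasDerivAt erf (2 / Real.sqrt Real.pi * Real.exp (-x ^ 2)) x := by
  have hc : Continuous fun s : ℝ => Real.exp (-s ^ 2) := by fun_prop
  exact (hc.integral_hasStrictDerivAt 0 x).hasDerivAt.const_mul _

theorem continuous_erf : Continuous erf :=
  continuous_iff_continuousAt.2 fun x => (hasDerivAt_erf x).continuousAt

@[simp]
theorem erf_zero : erf 0 = 0 := by simp [erf]

theorem erf_neg (x : ℝ) : erf (-x) = -erf x := by
  have h := intervalIntegral.integral_comp_neg (a := 0) (b := x)
    fun s : ℝ => Real.exp (-s ^ 2)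
  simp only [even_two.neg_pow, neg_zero] at h
  rw [erf, erf, intervalIntegral.integral_symm, ← h, mul_neg]

theorem abs_erf_le_two (x : ℝ) : |erf x| ≤ 2 := by
  have hπ : 0 < Real.sqrt Real.pi := Real.sqrt_pos.2 Real.pi_pos
  have h : |∫ s in (0 : ℝ)..x, Real.exp (-s ^ 2)| ≤ Real.sqrt Real.pi := by
    calc |∫ s in (0 : ℝ)..x, Real.exp (-s ^ 2)|
        ≤ ∫ s in Set.uIoc 0 x, ‖Real.exp (-s ^ 2)‖ := by
          rw [← Real.norm_eq_abs]
          exact intervalIntegral.norm_integral_le_integral_norm_uIoc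
      _ ≤ ∫ s : ℝ, ‖Real.exp (-s ^ 2)‖ :=
          setIntegral_le_integral integrable_exp_neg_sq.norm
            (Filter.Eventually.of_forall fun _ => norm_nonneg _)
      _ = Real.sqrt Real.pi := by
          simpa using integral_gaussian 1
  rw [erf, abs_mul, abs_of_pos (by positivity)]
  calc 2 / Real.sqrt Real.pi * |∫ s in (0 : ℝ)..x, Real.exp (-s ^ 2)|
      ≤ 2 / Real.sqrt Real.pi * Real.sqrt Real.pi := by gcongr
    _ = 2 := by field_simp

theorem integrable_gaussian_mul_erf (a b : ℝ) :
    Integrable fun x : ℝ => Real.exp (-x ^ 2) * erf (a * x + b) :=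
  integrable_exp_neg_sq.mul_bdd (c := 2)
    (continuous_erf.comp (by fun_prop)).aestronglyMeasurable
    (Filter.Eventually.of_forall fun _ => abs_erf_le_two _)

theorem integral_gaussian_mul_gaussian (a b : ℝ) :
    (∫ x : ℝ, Real.exp (-x ^ 2) * Real.exp (-(a * x + b) ^ 2)) =
      Real.sqrt (Real.pi / (1 + a ^ 2)) * Real.exp (-b ^ 2 / (1 + a ^ 2)) := by
  have ha : 1 + a ^ 2 ≠ 0 := by positivity
  have h (x : ℝ) : Real.exp (-x ^ 2) * Real.exp (-(a * x + b) ^ 2) =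
      Real.exp (-(1 + a ^ 2) * (x + a * b / (1 + a ^ 2)) ^ 2) *
        Real.exp (-b ^ 2 / (1 + a ^ 2)) := by
    rw [← Real.exp_add, ← Real.exp_add]
    congr 1
    field_simp
    ring
  simp_rw [h]
  rw [integral_mul_const,
    integral_add_right_eq_self (fun x : ℝ => Real.exp (-(1 + a ^ 2) * x ^ 2)),
    integral_gaussian]

theorem hasDerivAt_integral_gaussian_mul_erf (a b : ℝ) :
    HasDerivAt (fun t => ∫ x : ℝ, Real.exp (-x ^ 2) * erf (a * x + t))
      (∫ x : ℝ, Real.exp (-x ^ 2) *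
        (2 / Real.sqrt Real.pi * Real.exp (-(a * x + b) ^ 2))) b := by
  refine (hasDerivAt_integral_of_dominated_loc_of_deriv_le
    (F' := fun t x => Real.exp (-x ^ 2) *
      (2 / Real.sqrt Real.pi * Real.exp (-(a * x + t) ^ 2)))
    (bound := fun x => Real.exp (-x ^ 2) * (2 / Real.sqrt Real.pi))
    Filter.univ_mem
    (Filter.Eventually.of_forall fun t =>
      (integrable_gaussian_mul_erf a t).aestronglyMeasurable)
    (integrable_gaussian_mul_erf a b)
    (Continuous.aestronglyMeasurable (by fun_prop)) ?_
    (integrable_exp_neg_sq.mul_const _) ?_).2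
  · refine Filter.Eventually.of_forall fun x t _ => ?_
    rw [Real.norm_of_nonneg (by positivity)]
    gcongr
    refine mul_le_of_le_one_right (by positivity) (Real.exp_le_one_iff.2 ?_)
    exact neg_nonpos.2 (sq_nonneg _)
  · exact Filter.Eventually.of_forall fun x t _ =>
      ((hasDerivAt_erf _).comp_const_add (a * x) t).const_mul _

theorem integral_gaussian_mul_erf_mul (a : ℝ) :
    (∫ x : ℝ, Real.exp (-x ^ 2) * erf (a * x)) = 0 := by
  have h := integral_neg_eq_self (fun x : ℝ => Real.exp (-x ^ 2) * erf (a * x)) volume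
  simp only [even_two.neg_pow, mul_neg, erf_neg, integral_neg] at h
  linarith

/-- **Full-line Gaussian–erf integral:**
`∫_{−∞}^{∞} e^{−x²} erf(ax+b) dx = √π · erf(b/√(1+a²))`. -/
theorem integral_gaussian_mul_erf (a b : ℝ) :
    (∫ x : ℝ, Real.exp (-x ^ 2) * erf (a * x + b)) =
      Real.sqrt Real.pi * erf (b / Real.sqrt (1 + a ^ 2)) := by
  have hπ : 0 < Real.sqrt Real.pi := Real.sqrt_pos.2 Real.pi_pos
  have ha : 0 < 1 + a ^ 2 := by positivity
  have hs : 0 < Real.sqrt (1 + a ^ 2) := Real.sqrt_pos.2 ha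
  have hL := hasDerivAt_integral_gaussian_mul_erf a
  have hR (t : ℝ) : HasDerivAt
      (fun t => Real.sqrt Real.pi * erf (t / Real.sqrt (1 + a ^ 2))) _ t :=
    ((hasDerivAt_erf _).comp t
      ((hasDerivAt_id t).div_const (Real.sqrt (1 + a ^ 2)))).const_mul _
  refine congrFun (eq_of_fderiv_eq (𝕜 := ℝ) (fun t => (hL t).differentiableAt)
    (fun t => (hR t).differentiableAt) (fun t => ?_) 0 ?_) b
  · rw [(hL t).hasFDerivAt.fderiv, (hR t).hasFDerivAt.fderiv]
    congr 1
    simp_rw [mul_left_comm (Real.exp _)]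
    rw [integral_const_mul, integral_gaussian_mul_gaussian, Real.sqrt_div Real.pi_pos.le,
      id, div_pow, Real.sq_sqrt ha.le, neg_div]
    field_simp
  · simpa using integral_gaussian_mul_erf_mul a
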